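/- Define ḡ(x, y) = (x/σ²)(F(x) − F(y)) + (f(x) − f(y)), where f and F are the density and cumulative distribution function of N(0, σ²). Then ḡ(x, y) > 0 for all x ≠ y. -/

import Mathlib

set_option autoImplicit false

open MeasureTheory ProbabilityTheory Filter Finset Matrix

/-- The density of the Gaussian distribution `N(0, σ²)`. -/
noncomputable def gaussPdf (σ x : ℝ) : ℝ :=
  (σ * Real.sqrt (2 * Real.pi))⁻¹ * Real.exp (-(x ^ 2) / (2 * σ ^ 2))

/-- The cumulative distribution function of the Gaussian distribution `N(0, σ²)`. -/
noncomputable def gaussCdf (σ x : ℝ) : ℝ := ∫ t in Set.Iic x, gaussPdf σ t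

lemma gp_pos {σ : ℝ} (hσ : 0 < σ) (x : ℝ) : 0 < gaussPdf σ x := by
  unfold gaussPdf
  positivity

lemma gp_cont (σ : ℝ) : Continuous (gaussPdf σ) := by
  unfold gaussPdf
  fun_prop

lemma gp_int {σ : ℝ} (hσ : 0 < σ) : Integrable (gaussPdf σ) := by
  have h := (integrable_exp_neg_mul_sq (b := 1 / (2 * σ ^ 2)) (by positivity)).const_mul
    ((σ * Real.sqrt (2 * Real.pi))⁻¹)
  refine h.congr (Eventually.of_forall fun x => ?_)
  simp only [gaussPdf]
  congr 2
  ring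

lemma gp_deriv {σ : ℝ} (hσ : 0 < σ) (x : ℝ) :
    HasDerivAt (gaussPdf σ) (-(x / σ ^ 2) * gaussPdf σ x) x := by
  have h := ((((hasDerivAt_id x).pow 2).neg.div_const (2 * σ ^ 2)).exp).const_mul
    ((σ * Real.sqrt (2 * Real.pi))⁻¹)
  refine HasDerivAt.congr_deriv (f := gaussPdf σ) h ?_
  simp [gaussPdf]
  field_simp

lemma gc_deriv {σ : ℝ} (hσ : 0 < σ) (x : ℝ) :
    HasDerivAt (gaussCdf σ) (gaussPdf σ x) x := by
  have h : gaussCdf σ = fun y => (∫ t in (0 : ℝ)..y, gaussPdf σ t) + gaussCdf σ 0 := by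
    funext y
    have := intervalIntegral.integral_Iic_sub_Iic (μ := volume) (a := 0) (b := y)
      (gp_int hσ).integrableOn (gp_int hσ).integrableOn
    rw [← this]
    simp [gaussCdf]
  rw [h]
  exact ((gp_cont σ).integral_hasStrictDerivAt 0 x).hasDerivAt.add_const _

/-- `ḡ(x,y) = (x/σ²)(F(x) - F(y)) + (f(x) - f(y)) > 0` for all `x ≠ y`,
where `f, F` are the Gaussian density and CDF of `N(0,σ²)`. -/
theorem stmt_14 {σ : ℝ} (hσ : 0 < σ) :
    ∀ x y : ℝ, x ≠ y →
      0 < (x / σ ^ 2) * (gaussCdf σ x - gaussCdf σ y)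
            + (gaussPdf σ x - gaussPdf σ y) := by
  intro x y hxy
  let h : ℝ → ℝ := fun y => (x / σ ^ 2) * (gaussCdf σ x - gaussCdf σ y)
            + (gaussPdf σ x - gaussPdf σ y)
  have hd : ∀ y, HasDerivAt h ((y - x) / σ ^ 2 * gaussPdf σ y) y := by
    intro y
    have := (((gc_deriv hσ y).const_sub (gaussCdf σ x)).const_mul (x / σ ^ 2)).add
      ((gp_deriv hσ y).const_sub (gaussPdf σ x))
    refine HasDerivAt.congr_deriv (f := h) this ?_
    ring
  have hc : Continuous h := continuous_iff_continuousAt.2 fun y => (hd y).continuousAt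
  have h0 : h x = 0 := by simp [h]
  change 0 < h y
  rw [← h0]
  rcases lt_or_gt_of_ne hxy with hlt | hlt
  · refine strictMonoOn_of_deriv_pos (convex_Ici x) hc.continuousOn ?_
      (Set.mem_Ici.2 le_rfl) (Set.mem_Ici.2 hlt.le) hlt
    intro z hz
    rw [interior_Ici, Set.mem_Ioi] at hz
    rw [(hd z).deriv]
    exact mul_pos (div_pos (by linarith) (by positivity)) (gp_pos hσ z)
  · refine strictAntiOn_of_deriv_neg (convex_Iic x) hc.continuousOn ?_
      (Set.mem_Iic.2 hlt.le) (Set.mem_Iic.2 le_rfl) hlt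
    intro z hz
    rw [interior_Iic, Set.mem_Iio] at hz
    rw [(hd z).deriv]
    exact mul_neg_of_neg_of_pos (div_neg_of_neg_of_pos (by linarith) (by positivity)) (gp_pos hσ z)
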